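/- Power properties of the Fibonacci word: for a nonempty finite word ω over {a,b}: (1) ωω is a factor of F_∞ if and only if ω is a conjugate of F_k for some k ≥ 0, i.e., ω = C_i(F_k) for some 0 ≤ i ≤ f_k−1; (2) ωωω is a factor of F_∞ if and only if ω = C_i(F_k) for some k and 0 ≤ i ≤ f_{k-1}−2; (3) ωωωω is never a factor of F_∞ (the Fibonacci word contains no fourth powers). -/

import Mathlib

/-- Finite Fibonacci words: `Fw k = σ^k(a)` where `a = false`, `b = true`,
`σ(a) = ab`, `σ(b) = a`; so `Fw (k+2) = Fw (k+1) ++ Fw k`. -/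
def Fw : ℕ → List Bool
  | 0 => [false]
  | 1 => [false, true]
  | (k+2) => Fw (k+1) ++ Fw k

/-- The infinite Fibonacci word `F_∞` (0-indexed): since `Fw (n+1)` has length
`fib (n+3) > n`, its `n`-th letter is the `n`-th letter of `F_∞`. -/
def fw (n : ℕ) : Bool := (Fw (n+1)).getD n false

/-- Singular words, with index shifted by one: `sw n = s_{n-1}`.
`sw 0 = s_{-1} = a`, and `sw (n+1) = s_n = β_n · F_n · α_n⁻¹` where
`α_n` is the last letter of `F_n` and `β_n` the other letter. -/
def sw : ℕ → List Bool
  | 0 => [false]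
  | (n+1) => (!((Fw n).getLastD false)) :: (Fw n).dropLast

/-- The factor of `F_∞` of length `n` starting at (0-indexed) position `i`. -/
def seg (i n : ℕ) : List Bool := (List.range n).map (fun t => fw (i + t))

/-- `w` occurs in `F_∞` at (0-indexed) position `i`. -/
def OccursAt (w : List Bool) (i : ℕ) : Prop := seg i w.length = w

/-- `w` is a factor of `F_∞`. -/
def IsFactor (w : List Bool) : Prop := ∃ i, OccursAt w i

/-- Starting position of the `(p+1)`-st occurrence of `w` in `F_∞`
(occurrences enumerated by starting position, 0-indexed: `occPos w 0`
is the first occurrence, i.e. the paper's `ω_1`). -/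
noncomputable def occPos (w : List Bool) (p : ℕ) : ℕ := Nat.nth (OccursAt w) p

/-- A finite word viewed as an element of the free group on the alphabet. -/
def listToFree (w : List Bool) : FreeGroup Bool := (w.map FreeGroup.of).prod

/-- The gap `ν_{w,p}` (0-indexed in `p`: `gap w 0` is the paper's `ν_{w,1}`)
between the `(p+1)`-st and `(p+2)`-nd occurrences of `w`, as an element of the
free group: the separating word if the occurrences are separated or adjacent,
and the formal inverse of the overlap if they overlap. -/
noncomputable def gap (w : List Bool) (p : ℕ) : FreeGroup Bool :=
  if occPos w p + w.length ≤ occPos w (p+1) then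
    listToFree (seg (occPos w p + w.length) (occPos w (p+1) - (occPos w p + w.length)))
  else
    (listToFree (seg (occPos w (p+1)) (occPos w p + w.length - occPos w (p+1))))⁻¹

/-- The signed length `|ν_{w,p}|` of the gap (negative in the overlapped case). -/
noncomputable def gapLen (w : List Bool) (p : ℕ) : ℤ :=
  (occPos w (p+1) : ℤ) - ((occPos w p : ℤ) + (w.length : ℤ))

/-- `u` is a singular word (some `s_k`, `k ≥ -1`). -/
def IsSingular (u : List Bool) : Prop := ∃ n, u = sw n

/-- `u` is a singular kernel of `w`: a singular factor of `w` of maximal length. -/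
def IsKernelOf (u w : List Bool) : Prop :=
  IsSingular u ∧ u <:+: w ∧ ∀ v : List Bool, IsSingular v → v <:+: w → v.length ≤ u.length

/-- The excluded words `{ε, ab, ba, aba}`. -/
def excl : List (List Bool) := [[], [false, true], [true, false], [false, true, false]]

/-- The `i`-th conjugate `C_i(w)` (indices taken mod the length). -/
def conj (i : ℕ) (w : List Bool) : List Bool :=
  w.drop (i % w.length) ++ w.take (i % w.length)

/-- `sliceW u i j = u[i,j]`, the letters `i` through `j` of `u`, 1-indexed. -/
def sliceW (u : List Bool) (i j : ℕ) : List Bool := (u.take j).drop (i - 1)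

/-- The Fibonacci morphism `σ` on finite words. -/
def fibMorphism (w : List Bool) : List Bool :=
  w.flatMap fun c => if c then [false] else [false, true]

/-- `blockPos n` is the position in `F_∞ = σ(F_∞)` at which the `n`-th block `σ(fw n)` starts. -/
def blockPos : ℕ → ℕ
  | 0 => 0
  | n + 1 => blockPos n + if fw n then 1 else 2

/-- The factors of length `L` at positions `i` and `i + p` of `F_∞` agree; equivalently, the factor
of length `p + L` at position `i` has period `p`. -/
def Matches (i p L : ℕ) : Prop := ∀ t < L, fw (i + t) = fw (i + p + t)

theorem fibMorphism_append (u v : List Bool) :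
    fibMorphism (u ++ v) = fibMorphism u ++ fibMorphism v := by
  simp [fibMorphism]

theorem fibMorphism_Fw : ∀ k, fibMorphism (Fw k) = Fw (k + 1)
  | 0 => by simp [fibMorphism, Fw]
  | 1 => by simp [fibMorphism, Fw]
  | k + 2 => by
    rw [Fw, fibMorphism_append, fibMorphism_Fw (k + 1), fibMorphism_Fw k, ← Fw]

theorem fibMorphism_isRotated {u v : List Bool} (h : u ~r v) :
    fibMorphism u ~r fibMorphism v := by
  obtain ⟨n, hn, rfl⟩ := List.isRotated_iff_mod.1 h
  rw [List.rotate_eq_drop_append_take hn, fibMorphism_append]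
  conv_lhs => rw [← List.take_append_drop n u, fibMorphism_append]
  exact List.isRotated_append

theorem length_Fw : ∀ k, (Fw k).length = Nat.fib (k + 2)
  | 0 => by simp [Fw]
  | 1 => by simp [Fw, Nat.fib]
  | k + 2 => by
    rw [Fw, List.length_append, length_Fw (k + 1), length_Fw k, Nat.fib_add_two (n := k + 2)]
    ring

theorem Fw_prefix_succ : ∀ k, Fw k <+: Fw (k + 1)
  | 0 => by simp [Fw]
  | k + 1 => by rw [Fw]; exact List.prefix_append _ _

theorem Fw_prefix {j k : ℕ} (h : j ≤ k) : Fw j <+: Fw k := by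
  induction h with
  | refl => exact List.prefix_rfl
  | step _ ih => exact ih.trans (Fw_prefix_succ _)

theorem getElem_Fw {k n : ℕ} (h : n < (Fw k).length) : (Fw k)[n] = fw n := by
  have hn : n < (Fw (n + 1)).length := by
    rw [length_Fw]
    have : n + 3 ≤ Nat.fib (n + 3) + 1 := Nat.le_fib_add_one (n + 3)
    show n < Nat.fib (n + 3)
    omega
  have hfw : fw n = (Fw (n + 1))[n] := by simp [fw, List.getD_eq_getElem?_getD, hn]
  rw [hfw]
  rcases le_total k (n + 1) with hk | hk
  · exact (Fw_prefix hk).getElem h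
  · exact ((Fw_prefix hk).getElem hn).symm

@[simp]
theorem length_seg (i n : ℕ) : (seg i n).length = n := by simp [seg]

@[simp]
theorem getElem_seg {i n t : ℕ} (h : t < (seg i n).length) : (seg i n)[t] = fw (i + t) := by
  simp [seg]

theorem seg_add (i m n : ℕ) : seg i (m + n) = seg i m ++ seg (i + m) n := by
  simp [seg, List.range_add, add_assoc]

theorem seg_one (i : ℕ) : seg i 1 = [fw i] := by simp [seg]

theorem eq_seg_zero_of_prefix {w : List Bool} {n : ℕ} (h : w <+: seg 0 n) :
    w = seg 0 w.length := by
  apply List.ext_getElem (by simp)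
  intro t h₁ h₂
  rw [h.getElem h₁]
  simp

theorem seg_zero_fib (k : ℕ) : seg 0 (Nat.fib (k + 2)) = Fw k := by
  apply List.ext_getElem (by simp [length_Fw])
  intro t h₁ h₂
  simp [getElem_Fw]

theorem fibMorphism_seg_zero (n : ℕ) : fibMorphism (seg 0 n) = seg 0 (blockPos n) := by
  have hlen : (fibMorphism (seg 0 n)).length = blockPos n := by
    induction n with
    | zero => rfl
    | succ n ih =>
      rw [seg_add, fibMorphism_append, List.length_append, ih, blockPos, zero_add, seg_one]
      cases fw n <;> rfl
  obtain ⟨r, hr⟩ : ∃ r, Nat.fib (n + 2) = n + r :=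
    Nat.exists_eq_add_of_le (by have := Nat.le_fib_add_one (n + 2); omega)
  rw [← hlen]
  apply eq_seg_zero_of_prefix (n := Nat.fib (n + 1 + 2))
  rw [seg_zero_fib, ← fibMorphism_Fw, ← seg_zero_fib n, hr, seg_add, fibMorphism_append]
  exact List.prefix_append _ _

theorem blockPos_fib (k : ℕ) : blockPos (Nat.fib (k + 2)) = Nat.fib (k + 3) := by
  have h := congrArg List.length (fibMorphism_seg_zero (Nat.fib (k + 2)))
  rw [seg_zero_fib, fibMorphism_Fw, length_Fw, length_seg] at h
  exact h.symm

theorem seg_blockPos (n : ℕ) :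
    seg (blockPos n) (if fw n then 1 else 2) = if fw n then [false] else [false, true] := by
  have h := fibMorphism_seg_zero (n + 1)
  rw [seg_add, fibMorphism_append, blockPos, seg_add, fibMorphism_seg_zero, zero_add, seg_one,
    zero_add] at h
  rw [← List.append_cancel_left h]
  simp [fibMorphism]

theorem fw_blockPos (n : ℕ) : fw (blockPos n) = false := by
  have h := seg_blockPos n
  cases hn : fw n <;> simpa [hn, seg, List.range_succ] using congrArg List.head? h

theorem blockPos_succ_of_true {n : ℕ} (h : fw n = true) : blockPos (n + 1) = blockPos n + 1 := by
  simp [blockPos, h]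

theorem blockPos_succ_of_false {n : ℕ} (h : fw n = false) :
    blockPos (n + 1) = blockPos n + 2 := by
  simp [blockPos, h]

theorem fw_blockPos_add_one (n : ℕ) : fw (blockPos n + 1) = !fw n := by
  cases hn : fw n
  · simpa [hn, seg, List.range_succ] using congrArg List.getLast? (seg_blockPos n)
  · rw [← blockPos_succ_of_true hn, fw_blockPos]; rfl

theorem strictMono_blockPos : StrictMono blockPos :=
  strictMono_nat_of_lt_succ fun n => by rw [blockPos]; split <;> omega

theorem exists_blockPos (j : ℕ) :
    ∃ n, j = blockPos n ∨ j = blockPos n + 1 ∧ fw n = false := by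
  induction j with
  | zero => exact ⟨0, Or.inl rfl⟩
  | succ j ih =>
    obtain ⟨n, rfl | ⟨rfl, hn⟩⟩ := ih
    · cases hn : fw n
      · exact ⟨n, Or.inr ⟨rfl, hn⟩⟩
      · exact ⟨n + 1, Or.inl (blockPos_succ_of_true hn).symm⟩
    · exact ⟨n + 1, Or.inl (blockPos_succ_of_false hn).symm⟩

theorem exists_blockPos_of_false {j : ℕ} (h : fw j = false) : ∃ n, j = blockPos n := by
  obtain ⟨n, hn | ⟨rfl, hn⟩⟩ := exists_blockPos j
  · exact ⟨n, hn⟩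
  · simp [fw_blockPos_add_one, hn] at h

theorem exists_blockPos_of_true {j : ℕ} (h : fw j = true) :
    ∃ n, j = blockPos n + 1 ∧ fw n = false := by
  obtain ⟨n, rfl | hn⟩ := exists_blockPos j
  · simp [fw_blockPos] at h
  · exact ⟨n, hn⟩

theorem fw_succ_of_true {j : ℕ} (h : fw j = true) : fw (j + 1) = false := by
  obtain ⟨n, rfl, hn⟩ := exists_blockPos_of_true h
  rw [add_assoc, ← blockPos_succ_of_false hn, fw_blockPos]

theorem fw_of_succ_true {j : ℕ} (h : fw (j + 1) = true) : fw j = false := by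
  cases hj : fw j
  · rfl
  · simp [fw_succ_of_true hj] at h

theorem exists_pred_of_true {j : ℕ} (h : fw j = true) : ∃ i, j = i + 1 ∧ fw i = false := by
  obtain ⟨n, rfl, -⟩ := exists_blockPos_of_true h
  exact ⟨_, rfl, fw_blockPos n⟩

/-- `aaa` is not a factor of `F_∞`. -/
theorem fw_add_two_of_false {j : ℕ} (h₀ : fw j = false) (h₁ : fw (j + 1) = false) :
    fw (j + 2) = true := by
  obtain ⟨n, rfl⟩ := exists_blockPos_of_false h₀
  have hn : fw n = true := by simpa [fw_blockPos_add_one] using h₁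
  have := fw_blockPos_add_one (n + 1)
  rwa [blockPos_succ_of_true hn, fw_succ_of_true hn] at this

theorem blockPos_add_two_ge (n : ℕ) : blockPos n + 3 ≤ blockPos (n + 2) := by
  cases h : fw n
  · have h₁ := blockPos_succ_of_false h
    have h₂ : blockPos (n + 1) < blockPos (n + 2) := strictMono_blockPos (Nat.lt_succ_self _)
    omega
  · rw [blockPos_succ_of_false (fw_succ_of_true h), blockPos_succ_of_true h]

theorem fibMorphism_seg (i n : ℕ) :
    fibMorphism (seg i n) = seg (blockPos i) (blockPos (i + n) - blockPos i) := by
  have h := fibMorphism_seg_zero (i + n)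
  have hle : blockPos i ≤ blockPos (i + n) := strictMono_blockPos.monotone (Nat.le_add_right i n)
  obtain ⟨r, hr⟩ := Nat.exists_eq_add_of_le hle
  rw [hr, seg_add, seg_add, fibMorphism_append, fibMorphism_seg_zero, zero_add, zero_add] at h
  rw [hr, Nat.add_sub_cancel_left]
  exact List.append_cancel_left h

theorem Matches.mono {i p L L' : ℕ} (h : Matches i p L) (hL : L' ≤ L) : Matches i p L' :=
  fun t ht => h t (ht.trans_le hL)

theorem Matches.succ {i p L : ℕ} (h : Matches i p L) (h' : fw (i + L) = fw (i + p + L)) :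
    Matches i p (L + 1) := by
  intro t ht
  rcases Nat.lt_succ_iff_lt_or_eq.1 ht with ht | rfl
  exacts [h t ht, h']

theorem Matches.cons {i p L : ℕ} (h : Matches (i + 1) p L) (h' : fw i = fw (i + p)) :
    Matches i p (L + 1) := by
  rintro (_ | t) ht
  · exact h'
  · have := h t (by omega)
    rwa [show i + 1 + t = i + (t + 1) by ring, show i + 1 + p + t = i + p + (t + 1) by ring] at this

theorem matches_iff_seg {i p L : ℕ} : Matches i p L ↔ seg i L = seg (i + p) L := by
  simp [Matches, seg]

/-- Moving along a run of period `p` rotates its period. -/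
theorem Matches.seg_add_eq_rotate {i p d : ℕ} (h : Matches i p d) (hd : d ≤ p) :
    seg (i + d) p = (seg i p).rotate d := by
  rw [List.rotate_eq_drop_append_take (by simpa using hd)]
  obtain ⟨r, rfl⟩ := Nat.exists_eq_add_of_le hd
  have h₁ : (seg i (d + r)).drop d = seg (i + d) r := by
    rw [seg_add, List.drop_left' (length_seg i d)]
  have h₂ : (seg i (d + r)).take d = seg i d := by
    rw [seg_add, List.take_left' (length_seg i d)]
  rw [h₁, h₂, add_comm d r, seg_add, matches_iff_seg.1 h]
  congr 2
  ring

theorem Matches.blockPos_add {m q L : ℕ} (h : Matches m q L) :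
    ∀ t ≤ L, blockPos (m + q + t) + blockPos m = blockPos (m + t) + blockPos (m + q) := by
  intro t
  induction t with
  | zero => intro; simp [add_comm]
  | succ t ih =>
    intro ht
    have h₁ := ih (by omega)
    have h₂ := h t (by omega)
    rw [← add_assoc, ← add_assoc, blockPos, blockPos, ← h₂]
    omega

/-- Applying `σ` to a run yields a run; it extends by one letter, since all blocks start alike. -/
theorem Matches.image {m q p L : ℕ} (h : Matches m q L) (hp : blockPos (m + q) = blockPos m + p) :
    Matches (blockPos m) p (blockPos (m + L) - blockPos m + 1) := by
  induction L with
  | zero =>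
    intro t ht
    obtain rfl : t = 0 := by simpa using ht
    simp [← hp, fw_blockPos]
  | succ L ih =>
    have h₁ := ih (h.mono (Nat.le_succ L))
    have h₂ := h.blockPos_add L (Nat.le_succ L)
    have h₃ := h L (Nat.lt_succ_self L)
    have h₄ : blockPos m ≤ blockPos (m + L) :=
      strictMono_blockPos.monotone (Nat.le_add_right m L)
    have h₅ := h.blockPos_add (L + 1) le_rfl
    have hend : fw (blockPos (m + (L + 1))) = fw (blockPos (m + q + (L + 1))) := by
      rw [fw_blockPos, fw_blockPos]
    cases hc : fw (m + L)
    · have h₆ : blockPos (m + (L + 1)) = blockPos (m + L) + 2 := blockPos_succ_of_false hc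
      have hmid : fw (blockPos (m + L) + 1) = fw (blockPos (m + q + L) + 1) := by
        rw [fw_blockPos_add_one, fw_blockPos_add_one, h₃]
      rw [h₆, show blockPos (m + L) + 2 - blockPos m + 1 =
        blockPos (m + L) - blockPos m + 1 + 1 + 1 by omega]
      refine (h₁.succ ?_).succ ?_
      · convert hmid using 2 <;> omega
      · convert hend using 2 <;> omega
    · have h₆ : blockPos (m + (L + 1)) = blockPos (m + L) + 1 := blockPos_succ_of_true hc
      rw [h₆, show blockPos (m + L) + 1 - blockPos m + 1 =
        blockPos (m + L) - blockPos m + 1 + 1 by omega]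
      refine h₁.succ ?_
      convert hend using 2 <;> omega

/-- A run between block boundaries comes from a run of the preimage under `σ`. -/
theorem Matches.exists_preimage {m q p L : ℕ} (hp : blockPos (m + q) = blockPos m + p)
    (h : Matches (blockPos m) p L) :
    ∃ L', Matches m q L' ∧ blockPos (m + L') ≤ blockPos m + L ∧
      blockPos m + L ≤ blockPos (m + L') + 1 := by
  induction L with
  | zero => exact ⟨0, fun t ht => absurd ht (Nat.not_lt_zero t), by simp⟩
  | succ L ih =>
    obtain ⟨L', h₁, h₂, h₃⟩ := ih (h.mono (Nat.le_succ L))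
    rcases h₃.eq_or_lt with h₄ | h₄
    · have h₅ := h L (Nat.lt_succ_self L)
      have h₆ := h₁.blockPos_add L' le_rfl
      rw [h₄, show blockPos m + p + L = blockPos (m + q + L') + 1 by omega,
        fw_blockPos_add_one, fw_blockPos_add_one, Bool.not_inj_iff] at h₅
      refine ⟨L' + 1, h₁.succ h₅, ?_⟩
      have h₇ : blockPos (m + (L' + 1)) = blockPos (m + L') + _ := rfl
      rw [h₇]
      split <;> omega
    · exact ⟨L', h₁, by omega, by omega⟩

/-- Two block boundaries at distance `p ≥ 2` bound the image of a nonempty word of length less than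
`p`. -/
theorem exists_blocks {i p : ℕ} (hp : 2 ≤ p) (h₀ : fw i = false) (h₁ : fw (i + p) = false) :
    ∃ m q, i = blockPos m ∧ blockPos (m + q) = blockPos m + p ∧ 1 ≤ q ∧ q < p := by
  obtain ⟨m, rfl⟩ := exists_blockPos_of_false h₀
  obtain ⟨n, hn⟩ := exists_blockPos_of_false h₁
  have hmn : m < n := strictMono_blockPos.lt_iff_lt.1 (by omega)
  obtain ⟨q, rfl⟩ := Nat.exists_eq_add_of_le hmn.le
  refine ⟨m, q, rfl, hn.symm, by omega, ?_⟩
  rcases Nat.lt_or_ge q 2 with hq | hq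
  · omega
  · obtain ⟨r, rfl⟩ := Nat.exists_eq_add_of_le hq
    have h₂ := blockPos_add_two_ge m
    have h₃ := strictMono_blockPos.add_le_nat r (m + 2)
    rw [show r + (m + 2) = m + (2 + r) by ring] at h₃
    omega

theorem seg_isRotated_Fw_of_blockPos {m q p k : ℕ} (hp : blockPos (m + q) = blockPos m + p)
    (h : seg m q ~r Fw k) : seg (blockPos m) p ~r Fw (k + 1) := by
  have := fibMorphism_isRotated h
  rwa [fibMorphism_Fw, fibMorphism_seg, hp, Nat.add_sub_cancel_left] at this

theorem seg_succ_isRotated {i p : ℕ} (h : fw i = fw (i + p)) (hp : 1 ≤ p) :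
    seg i p ~r seg (i + 1) p :=
  ⟨1, (Matches.seg_add_eq_rotate (d := 1)
    (fun t ht => by obtain rfl : t = 0 := by omega
                    exact h) hp).symm⟩

/-- If `ωω` occurs in `F_∞`, then `ω` is a conjugate of some `F_k`. -/
theorem Matches.exists_isRotated_Fw {i p : ℕ} (hp : 1 ≤ p) (h : Matches i p p) :
    ∃ k, seg i p ~r Fw k := by
  induction p using Nat.strong_induction_on generalizing i with
  | _ p ih =>
  rcases hp.eq_or_lt with rfl | hp2
  · have h₀ := h 0 one_pos
    refine ⟨0, ?_⟩
    cases hi : fw i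
    · rw [seg_one, hi]; exact List.IsRotated.refl _
    · simp [hi, fw_succ_of_true hi] at h₀
  have key : ∀ {i}, Matches i p p → fw i = false → ∃ k, seg i p ~r Fw k := by
    intro i h hi
    obtain ⟨m, q, rfl, hq, hq1, hqp⟩ := exists_blocks hp2 hi (by rw [← hi]; exact (h 0 hp).symm)
    have lift : (∃ k, seg m q ~r Fw k) → ∃ k, seg (blockPos m) p ~r Fw k :=
      fun ⟨k, hk⟩ => ⟨k + 1, seg_isRotated_Fw_of_blockPos hq hk⟩
    by_cases hmm : Matches m q q
    · exact lift (ih q hqp hq1 hmm)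
    obtain ⟨L, hL, hL1, hL2⟩ := h.exists_preimage hq
    have hLq : L < q := by
      by_contra! hcon
      exact hmm (hL.mono hcon)
    -- the preimage is `w b w a` with `|w| = q - 1`
    obtain rfl : q = L + 1 := by
      by_contra hne
      have h₁ := blockPos_add_two_ge (m + L)
      have h₂ := strictMono_blockPos.monotone (show m + L + 2 ≤ m + q by omega)
      omega
    have hb : fw (m + L) = true := by
      by_contra hcon
      have := blockPos_succ_of_false (Bool.eq_false_iff.2 hcon)
      rw [← add_assoc] at hq
      omega
    have hL0 : 0 < L := by
      rcases Nat.eq_zero_or_pos L with rfl | hL0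
      · have := blockPos_succ_of_true hb
        simp only [zero_add, add_zero] at *
        omega
      · exact hL0
    have hm1 : fw (m + (L + 1)) = false := fw_succ_of_true hb
    have hm0 : fw m = false := by rw [← hm1]; exact hL 0 hL0
    obtain ⟨μ, r, rfl, hr, hr1, hrq⟩ := exists_blocks (by omega) hm0 hm1
    have lift' : (∃ k, seg μ r ~r Fw k) → ∃ k, seg (blockPos (blockPos μ)) p ~r Fw k :=
      fun ⟨k, hk⟩ => lift ⟨k + 1, seg_isRotated_Fw_of_blockPos hr hk⟩
    by_cases hμ : Matches μ r r
    · exact lift' (ih r (by omega) hr1 hμ)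
    obtain ⟨M, hM, hM1, hM2⟩ := hL.exists_preimage hr
    have hMr : M < r := by
      by_contra! hcon
      exact hμ (hM.mono hcon)
    -- the second preimage is `u a u b` with `|u| = r - 1`
    have ha : r = M + 1 ∧ fw (μ + M) = false := by
      obtain ⟨s, rfl⟩ : ∃ s, r = s + 1 := ⟨r - 1, by omega⟩
      have hs : fw (μ + s) = false := by
        by_contra hcon
        have h₁ := blockPos_succ_of_true (Bool.eq_true_of_not_eq_false hcon)
        have h₂ := fw_blockPos (μ + s)
        rw [← add_assoc, h₁] at hr
        rw [show blockPos (μ + s) = blockPos μ + L by omega, hb] at h₂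
        cases h₂
      have h₁ := blockPos_succ_of_false hs
      have h₂ : μ + s ≤ μ + M := strictMono_blockPos.le_iff_le.1 (by rw [← add_assoc] at hr; omega)
      obtain rfl : s = M := by omega
      exact ⟨rfl, hs⟩
    obtain ⟨rfl, ha⟩ := ha
    rcases Nat.eq_zero_or_pos M with rfl | hM0
    · refine lift' ⟨0, ?_⟩
      rw [zero_add, seg_one, show fw μ = false from ha]
      exact List.IsRotated.refl _
    obtain ⟨N, rfl⟩ : ∃ N, M = N + 1 := ⟨M - 1, by omega⟩
    have hend : fw (μ + (N + 1 + 1) + (N + 1)) = true := by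
      by_contra hcon
      exact hμ (hM.succ (by rw [ha, Bool.eq_false_iff.2 hcon]))
    have hN : fw (μ + N) = false := by
      rw [hM N (Nat.lt_succ_self N)]
      exact fw_of_succ_true hend
    have hμ1 : fw μ = true := by
      have h₁ := hM 0 hM0
      simp only [add_zero] at h₁
      rw [h₁]
      exact fw_add_two_of_false hN ha
    obtain ⟨κ, rfl, hκ⟩ := exists_pred_of_true hμ1
    have hκ' : fw κ = fw (κ + (N + 1 + 1)) := by
      rw [hκ, ← ha]; congr 1; ring
    obtain ⟨k, hk⟩ := ih (N + 1 + 1) (by omega) hr1 (hM.cons hκ')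
    exact lift' ⟨k, (seg_succ_isRotated hκ' hr1).symm.trans hk⟩
  cases hi : fw i
  · exact key h hi
  · obtain ⟨j, rfl, hj⟩ := exists_pred_of_true hi
    have hj' : fw j = fw (j + p) := by
      rw [hj]
      symm
      apply fw_of_succ_true
      rw [← hi, show j + p + 1 = j + 1 + p + 0 by ring, ← h 0 hp]
    obtain ⟨k, hk⟩ := key ((h.cons hj').mono (Nat.le_succ p)) hj
    exact ⟨k, (seg_succ_isRotated hj' hp).symm.trans hk⟩

theorem blockPos_add_of_seg_eq {i k r : ℕ} (h : seg i (Nat.fib (k + 2)) = Fw k)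
    (hr : r ≤ Nat.fib (k + 2)) : blockPos (i + r) = blockPos i + blockPos r := by
  rw [← seg_zero_fib] at h
  have hm : Matches 0 i (Nat.fib (k + 2)) := by
    rw [matches_iff_seg, zero_add, h]
  have := hm.blockPos_add r hr
  simp only [zero_add] at this
  have h0 : blockPos 0 = 0 := rfl
  omega

theorem seg_blockPos_eq_Fw {i k : ℕ} (h : seg i (Nat.fib (k + 2)) = Fw k) :
    seg (blockPos i) (Nat.fib (k + 3)) = Fw (k + 1) := by
  have h₁ := fibMorphism_seg i (Nat.fib (k + 2))
  rwa [blockPos_add_of_seg_eq h le_rfl, Nat.add_sub_cancel_left, blockPos_fib, h,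
    fibMorphism_Fw, eq_comm] at h₁

/-- Block positions two periods into a run. -/
theorem Matches.blockPos_add_two_periods {i k r : ℕ} (h : seg i (Nat.fib (k + 2)) = Fw k)
    (hm : Matches i (Nat.fib (k + 2)) (Nat.fib (k + 2) + r)) (hr : r ≤ Nat.fib (k + 2)) :
    blockPos (i + (2 * Nat.fib (k + 2) + r)) =
      blockPos i + 2 * Nat.fib (k + 3) + blockPos r := by
  have h₁ := blockPos_add_of_seg_eq h le_rfl
  have h₂ := blockPos_add_of_seg_eq h hr
  have h₃ := hm.blockPos_add _ le_rfl
  have h₄ := hm.blockPos_add r (Nat.le_add_left _ _)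
  rw [blockPos_fib] at h₁
  rw [show i + (2 * Nat.fib (k + 2) + r) = i + Nat.fib (k + 2) + (Nat.fib (k + 2) + r) by ring]
  rw [← add_assoc i (Nat.fib (k + 2)) r] at h₃
  omega

/-- A run of period `p` and length at least `3p - 1` sits inside a run starting with some `F_k`,
`f_k = p`, and ends at most `3 f_k + f_{k-1} - 2` letters after the start of the latter. -/
theorem Matches.exists_run {i p L : ℕ} (hp : 1 ≤ p) (hL : 2 * p ≤ L + 1) (h : Matches i p L) :
    ∃ k d j, i = j + d ∧ p = Nat.fib (k + 2) ∧ seg j p = Fw k ∧ Matches j p (d + L) ∧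
      d + L + 2 ≤ 2 * Nat.fib (k + 2) + Nat.fib (k + 1) := by
  induction p using Nat.strong_induction_on generalizing i L with
  | _ p ih =>
  rcases hp.eq_or_lt with rfl | hp2
  · have h₀ : fw i = fw (i + 1) := h 0 (by omega)
    have hi : fw i = false := by
      cases hi : fw i
      · rfl
      · rw [← hi, h₀, fw_succ_of_true hi]
    refine ⟨0, 0, i, rfl, rfl, by rw [seg_one, hi]; rfl, by simpa using h, ?_⟩
    by_contra! hcon
    have h₁ : fw (i + 1) = fw (i + 2) := h 1 (by simp at hcon; omega)
    rw [fw_add_two_of_false hi (h₀ ▸ hi), ← h₀, hi] at h₁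
    cases h₁
  have key : ∀ {i L}, 2 * p ≤ L + 1 → Matches i p L → fw i = false →
      ∃ k d j, i = j + d ∧ p = Nat.fib (k + 2) ∧ seg j p = Fw k ∧ Matches j p (d + L) ∧
        d + L + 2 ≤ 2 * Nat.fib (k + 2) + Nat.fib (k + 1) := by
    intro i L hL h hi
    obtain ⟨m, q, rfl, hq, hq1, hqp⟩ :=
      exists_blocks hp2 hi (by rw [← hi]; exact (h 0 (by omega)).symm)
    obtain ⟨M, hM, hM1, hM2⟩ := h.exists_preimage hq
    have hMq : 2 * q ≤ M + 1 := by
      by_contra! hcon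
      rcases Nat.lt_or_ge M q with hlt | hge
      · have := strictMono_blockPos (show m + M < m + q by omega)
        omega
      · obtain ⟨s, rfl⟩ := Nat.exists_eq_add_of_le hge
        have h₁ := hM.blockPos_add s (Nat.le_add_left _ _)
        have h₂ := blockPos_add_two_ge (m + s)
        have h₃ := strictMono_blockPos.monotone (show m + s + 2 ≤ m + q by omega)
        rw [add_assoc m q s] at h₁
        omega
    obtain ⟨k, d, j, rfl, rfl, hseg, hrun, hbound⟩ := ih q hqp hq1 hMq hM
    have hj := blockPos_add_of_seg_eq hseg le_rfl
    rw [blockPos_fib] at hj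
    have hshift := hrun.blockPos_add d (Nat.le_add_right _ _)
    rw [add_right_comm] at hshift
    obtain rfl : p = Nat.fib (k + 3) := by omega
    have hjd : blockPos j ≤ blockPos (j + d) :=
      strictMono_blockPos.monotone (Nat.le_add_right _ _)
    have hup := hrun.image hj
    rw [← add_assoc] at hup
    have hle : blockPos (j + d + M) + 3 ≤
        blockPos j + (2 * Nat.fib (k + 3) + Nat.fib (k + 2)) := by
      rcases Nat.lt_or_ge (d + M) (2 * Nat.fib (k + 2)) with hlt | hge
      · rcases k with _ | k
        · simp at *
          have : d = 0 ∧ M = 1 := by omega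
          obtain ⟨rfl, rfl⟩ := this
          simp [Nat.fib] at *
          omega
        · have hpos : 0 < Nat.fib (k + 2) := Nat.fib_pos.2 (by omega)
          have hpos' : 0 < Nat.fib (k + 1) := Nat.fib_pos.2 (by omega)
          have hrec : Nat.fib (k + 3) = Nat.fib (k + 1) + Nat.fib (k + 2) := Nat.fib_add_two
          obtain ⟨s, hs⟩ : ∃ s, d + M = Nat.fib (k + 3) + s :=
            Nat.exists_eq_add_of_le (by simp only [add_assoc, Nat.reduceAdd] at *; omega)
          have h₁ := hrun.blockPos_add s (by simp only [add_assoc, Nat.reduceAdd] at *; omega)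
          have h₂ := strictMono_blockPos (show j + s < j + Nat.fib (k + 3) by
            simp only [add_assoc, Nat.reduceAdd] at *; omega)
          rw [add_assoc j d M, hs, ← add_assoc]
          simp only [add_assoc, Nat.reduceAdd] at *
          omega
      · obtain ⟨s, hs⟩ := Nat.exists_eq_add_of_le hge
        have hfib : Nat.fib (k + 1) ≤ Nat.fib (k + 2) := Nat.fib_le_fib_succ
        have h₁ := (hrun.mono (show Nat.fib (k + 2) + s ≤ d + M by
          omega)).blockPos_add_two_periods hseg (by omega)
        have h₂ := blockPos_add_two_ge s
        have h₃ := strictMono_blockPos.monotone (show s + 2 ≤ Nat.fib (k + 1) by omega)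
        rw [add_assoc j d M, hs, h₁]
        rcases k with _ | k
        · simp at h₃ hbound; omega
        · rw [blockPos_fib] at h₃
          simp only [add_assoc, Nat.reduceAdd] at *
          omega
    exact ⟨k + 1, blockPos (j + d) - blockPos j, blockPos j, by omega, rfl,
      seg_blockPos_eq_Fw hseg, hup.mono (by omega),
      by simp only [add_assoc, Nat.reduceAdd] at *; omega⟩
  cases hi : fw i
  · exact key hL h hi
  · obtain ⟨j, rfl, hj⟩ := exists_pred_of_true hi
    have hj' : fw j = fw (j + p) := by
      rw [hj]
      symm
      apply fw_of_succ_true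
      rw [← hi, show j + p + 1 = j + 1 + p + 0 by ring, ← h 0 (by omega)]
    obtain ⟨k, d, l, rfl, hpk, hseg, hrun, hbound⟩ := key (by omega) (h.cons hj') hj
    exact ⟨k, d + 1, l, rfl, hpk, hseg, by rwa [add_right_comm, add_assoc], by omega⟩

/-- `F_k` with `k ≥ 1` does not end in `aa`, so dropping its last two letters shortens its image
under `σ` by at most three. -/
theorem blockPos_fib_le (k r : ℕ) (h : r + 2 = Nat.fib (k + 3)) :
    Nat.fib (k + 4) ≤ blockPos r + 3 := by
  have hmain : ∀ k r, r + 2 = Nat.fib (k + 3) → fw r = true ∨ fw (r + 1) = true := by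
    intro k
    induction k using Nat.twoStepInduction with
    | zero =>
      intro r hr
      obtain rfl : r = 0 := by simpa [Nat.fib] using hr
      exact Or.inr rfl
    | one =>
      intro r hr
      obtain rfl : r = 1 := by simpa [Nat.fib] using hr
      exact Or.inl rfl
    | more k ih _ =>
      intro r hr
      have h2 : 2 ≤ Nat.fib (k + 3) := Nat.fib_mono (show 3 ≤ k + 3 by omega)
      obtain ⟨s, hs⟩ := Nat.exists_eq_add_of_le' h2
      have hrec : Nat.fib (k + 5) = Nat.fib (k + 3) + Nat.fib (k + 4) := Nat.fib_add_two
      have hm : Matches 0 (Nat.fib (k + 4)) (Nat.fib (k + 3)) := by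
        have h₁ := seg_zero_fib (k + 3)
        rw [Fw, show k + 3 + 2 = k + 5 from rfl, hrec, add_comm, seg_add] at h₁
        have h₂ := seg_zero_fib (k + 2)
        rw [← h₂] at h₁
        have h₃ := List.append_cancel_left h₁
        rw [matches_iff_seg, h₃, seg_zero_fib (k + 1)]
      have e₀ := hm s (by omega)
      have e₁ := hm (s + 1) (by omega)
      simp only [zero_add] at e₀ e₁
      obtain rfl : r = Nat.fib (k + 4) + s := by
        simp only [add_assoc, Nat.reduceAdd] at *; omega
      rw [← e₀, add_assoc, ← e₁]
      exact ih s hs.symm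
  have hfib := blockPos_fib (k + 1)
  rw [show k + 1 + 2 = k + 3 from rfl, ← h] at hfib
  have hle : blockPos (r + 2) ≤ blockPos r + 3 := by
    rcases hmain k r h with h₁ | h₁
    · rw [blockPos_succ_of_false (fw_succ_of_true h₁), blockPos_succ_of_true h₁]
    · rw [blockPos_succ_of_true h₁, blockPos_succ_of_false (fw_of_succ_true h₁)]
  rw [hfib] at hle
  exact hle

/-- `F_∞` contains a run of period `f_k` and length `3 f_k + f_{k-1} - 2` starting with `F_k`. -/
theorem exists_long_run (k : ℕ) : ∃ j L, seg j (Nat.fib (k + 2)) = Fw k ∧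
    Matches j (Nat.fib (k + 2)) L ∧ L + 2 = 2 * Nat.fib (k + 2) + Nat.fib (k + 1) := by
  have step : ∀ k j L, seg j (Nat.fib (k + 2)) = Fw k → Matches j (Nat.fib (k + 2)) L →
      blockPos j + (2 * Nat.fib (k + 3) + Nat.fib (k + 2)) ≤ blockPos (j + L) + 3 →
      ∃ j L, seg j (Nat.fib (k + 3)) = Fw (k + 1) ∧
        Matches j (Nat.fib (k + 3)) L ∧ L + 2 = 2 * Nat.fib (k + 3) + Nat.fib (k + 2) := by
    intro k j L hseg hm hle
    have hj := blockPos_add_of_seg_eq hseg le_rfl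
    rw [blockPos_fib] at hj
    have h2 : 2 ≤ Nat.fib (k + 3) := Nat.fib_mono (show 3 ≤ k + 3 by omega)
    exact ⟨blockPos j, 2 * Nat.fib (k + 3) + Nat.fib (k + 2) - 2, seg_blockPos_eq_Fw hseg,
      (hm.image hj).mono (by omega), by omega⟩
  have base : seg 2 (Nat.fib 2) = Fw 0 ∧ Matches 2 (Nat.fib 2) 1 :=
    ⟨rfl, matches_iff_seg.2 rfl⟩
  have base' : seg 3 (Nat.fib 3) = Fw 1 ∧ Matches 3 (Nat.fib 3) 3 :=
    ⟨rfl, matches_iff_seg.2 rfl⟩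
  induction k with
  | zero => exact ⟨2, 1, base.1, base.2, rfl⟩
  | succ k ih =>
    rcases k with _ | _ | k
    · exact ⟨3, 3, base'.1, base'.2, rfl⟩
    · exact step 1 3 3 base'.1 base'.2 (by decide)
    · obtain ⟨j, L, hseg, hm, hL⟩ := ih
      refine step _ j L hseg hm ?_
      simp only [add_assoc, Nat.reduceAdd] at *
      have h2 : 2 ≤ Nat.fib (k + 3) := Nat.fib_mono (show 3 ≤ k + 3 by omega)
      obtain ⟨r, hr⟩ := Nat.exists_eq_add_of_le' h2
      have hfib : Nat.fib (k + 3) ≤ Nat.fib (k + 4) := Nat.fib_le_fib_succ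
      have h₁ := (hm.mono (show Nat.fib (k + 4) + r ≤ L by
        omega)).blockPos_add_two_periods (k := k + 2) hseg (show r ≤ Nat.fib (k + 4) by omega)
      have h₂ := blockPos_fib_le k r hr.symm
      obtain rfl : L = 2 * Nat.fib (k + 4) + r := by omega
      simp only [add_assoc, Nat.reduceAdd] at *
      omega

theorem isFactor_append_self_iff {ω : List Bool} :
    IsFactor (ω ++ ω) ↔ ∃ i, seg i ω.length = ω ∧ Matches i ω.length ω.length := by
  simp only [IsFactor, OccursAt, List.length_append, seg_add, matches_iff_seg]
  refine exists_congr fun i => ⟨fun h => ?_, fun ⟨h₁, h₂⟩ => ?_⟩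
  · obtain ⟨h₁, h₂⟩ := List.append_inj h (by simp)
    exact ⟨h₁, h₁.trans h₂.symm⟩
  · rw [← h₂, h₁]

theorem isFactor_cube_iff {ω : List Bool} :
    IsFactor (ω ++ ω ++ ω) ↔
      ∃ i, seg i ω.length = ω ∧ Matches i ω.length (ω.length + ω.length) := by
  simp only [IsFactor, OccursAt, List.length_append, seg_add, matches_iff_seg]
  refine exists_congr fun i => ⟨fun h => ?_, fun ⟨h₁, h₂⟩ => ?_⟩
  · obtain ⟨h₁₂, h₃⟩ := List.append_inj h (by simp)
    obtain ⟨h₁, h₂⟩ := List.append_inj h₁₂ (by simp)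
    rw [← add_assoc] at h₃
    exact ⟨h₁, by rw [h₁, h₂, h₃]⟩
  · obtain ⟨h₂, h₃⟩ := List.append_inj h₂ (by simp)
    rw [← add_assoc, ← h₃, ← h₂, h₁]

theorem Matches.of_isFactor_fourth {ω : List Bool} (h : IsFactor (ω ++ ω ++ ω ++ ω)) :
    ∃ i, Matches i ω.length (3 * ω.length) := by
  obtain ⟨i, h⟩ := h
  refine ⟨i, ?_⟩
  simp only [OccursAt, List.length_append, seg_add] at h
  obtain ⟨h, h₄⟩ := List.append_inj h (by simp)
  obtain ⟨h, h₃⟩ := List.append_inj h (by simp)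
  obtain ⟨h₁, h₂⟩ := List.append_inj h (by simp)
  rw [matches_iff_seg, show 3 * ω.length = ω.length + ω.length + ω.length by ring]
  simp only [seg_add, ← add_assoc] at *
  rw [h₁, h₂, h₃, h₄]

theorem conj_eq_rotate (i : ℕ) (w : List Bool) : conj i w = w.rotate i :=
  List.rotate_eq_drop_append_take_mod.symm

theorem Matches.add_left {i p d L : ℕ} (h : Matches i p (d + L)) : Matches (i + d) p L := by
  intro t ht
  have := h (d + t) (by omega)
  rwa [← add_assoc, ← add_assoc, add_right_comm i p d] at this

/-- for a nonempty word `ω` over `{a,b}`: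
(1) `ωω` is a factor of `F_∞` iff `ω = C_i(F_k)` for some `k` and `0 ≤ i ≤ f_k-1`;
(2) `ωωω` is a factor of `F_∞` iff `ω = C_i(F_k)` for some `k` and `0 ≤ i ≤ f_{k-1}-2`;
(3) `ωωωω` is never a factor of `F_∞`. -/
theorem stmt18 (ω : List Bool) (hne : ω ≠ []) :
    (IsFactor (ω ++ ω) ↔ ∃ k i : ℕ, i < Nat.fib (k+2) ∧ ω = conj i (Fw k)) ∧
    (IsFactor (ω ++ ω ++ ω) ↔ ∃ k i : ℕ, i + 2 ≤ Nat.fib (k+1) ∧ ω = conj i (Fw k)) ∧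
    ¬ IsFactor (ω ++ ω ++ ω ++ ω) := by
  have hpos : 1 ≤ ω.length := List.length_pos_iff.2 hne
  have hfib : ∀ k, Nat.fib (k + 1) ≤ Nat.fib (k + 2) := fun k => Nat.fib_le_fib_succ
  simp only [conj_eq_rotate]
  refine ⟨isFactor_append_self_iff.trans ⟨?_, ?_⟩, isFactor_cube_iff.trans ⟨?_, ?_⟩, ?_⟩
  · rintro ⟨i, hω, hm⟩
    obtain ⟨k, hk⟩ := hm.exists_isRotated_Fw hpos
    rw [hω] at hk
    obtain ⟨d, -, hd⟩ := List.isRotated_iff_mod.1 hk.symm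
    have hk0 : 0 < Nat.fib (k + 2) := Nat.fib_pos.2 (by omega)
    refine ⟨k, d % Nat.fib (k + 2), Nat.mod_lt _ hk0, ?_⟩
    rw [← length_Fw, List.rotate_mod, hd]
  · rintro ⟨k, d, hd, rfl⟩
    obtain ⟨j, L, hseg, hm, hL⟩ := exists_long_run k
    have hk1 : 0 < Nat.fib (k + 1) := Nat.fib_pos.2 (by omega)
    refine ⟨j + d, ?_⟩
    rw [List.length_rotate, length_Fw]
    rw [(hm.mono (by omega)).seg_add_eq_rotate hd.le, hseg]
    exact ⟨rfl, Matches.add_left (hm.mono (by omega))⟩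
  · rintro ⟨i, hω, hm⟩
    obtain ⟨k, d, j, rfl, hpk, hseg, hrun, hbound⟩ := hm.exists_run hpos (by omega)
    have hd : d + 2 ≤ Nat.fib (k + 1) := by omega
    refine ⟨k, d, hd, ?_⟩
    rw [← hseg, ← (hrun.mono (Nat.le_add_right _ _)).seg_add_eq_rotate
      (by have := hfib k; omega), hω]
  · rintro ⟨k, d, hd, rfl⟩
    obtain ⟨j, L, hseg, hm, hL⟩ := exists_long_run k
    have := hfib k
    refine ⟨j + d, ?_⟩
    rw [List.length_rotate, length_Fw]
    rw [(hm.mono (by omega)).seg_add_eq_rotate (by omega), hseg]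
    exact ⟨rfl, Matches.add_left (hm.mono (by omega))⟩
  · intro h
    obtain ⟨i, hm⟩ := Matches.of_isFactor_fourth h
    obtain ⟨k, d, j, -, hpk, -, -, hbound⟩ := hm.exists_run hpos (by omega)
    have := hfib k
    omega
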